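/- arXiv:1907.11915 — 10 statements merged into one kernel-verified Lean document; each statement's English description precedes it below -/
import Mathlib

section
/- Suppose m = 2. For every family of demand maps D_1, D_2 as in the model, a market clearing pure Nash equilibrium exists if and only if for every item i ∈ N: (v_{2,i} − c_i)/2 ≤ v_{1,i} − c_i ≤ 2(v_{2,i} − c_i) and min{v_{1,i}, v_{2,i}} ≥ c_i. Moreover, when this condition is satisfied, the market clearing pure Nash equilibrium is unique and is given by p_i = min{v_{1,i}, v_{2,i}} for all i ∈ N. -/
open Finset

/-- Utility of a buyer with valuation `v` for bundle `S` at prices `p`. -/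
def util {n : ℕ} (v : Finset (Fin n) → ℝ) (p : Fin n → ℝ) (S : Finset (Fin n)) : ℝ :=
  v S - ∑ i ∈ S, p i

/-- `v` is a normalized, nonnegative, monotone, submodular valuation. -/
def IsValuation {n : ℕ} (v : Finset (Fin n) → ℝ) : Prop :=
  v ∅ = 0 ∧ (∀ S, 0 ≤ v S) ∧ (∀ S T, S ⊆ T → v S ≤ v T) ∧
    ∀ (S T : Finset (Fin n)) (x : Fin n), S ⊆ T → x ∉ T →
      v (insert x T) - v T ≤ v (insert x S) - v S

/-- `v` is additive. -/
def IsAdditive {n : ℕ} (v : Finset (Fin n) → ℝ) : Prop :=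
  ∀ S, v S = ∑ i ∈ S, v {i}

/-- `D` is a demand map for valuation `v`: at every price vector it selects a
utility-maximizing bundle of maximum cardinality among maximizers. -/
def IsDemandMap {n : ℕ} (v : Finset (Fin n) → ℝ)
    (D : (Fin n → ℝ) → Finset (Fin n)) : Prop :=
  ∀ p, (∀ S, util v p S ≤ util v p (D p)) ∧
    ∀ S, util v p S = util v p (D p) → S.card ≤ (D p).card

/-- Profit of seller `i`: number of buyers purchasing item `i` times `p i - c i`. -/
def profit {n m : ℕ} (D : Fin m → (Fin n → ℝ) → Finset (Fin n)) (c : Fin n → ℝ)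
    (p : Fin n → ℝ) (i : Fin n) : ℝ :=
  ((Finset.univ.filter fun j : Fin m => i ∈ D j p).card : ℝ) * (p i - c i)

/-- Pure Nash equilibrium of the sellers' pricing game (prices are nonnegative
and no seller can strictly increase profit by a unilateral price change). -/
def IsPNE {n m : ℕ} (D : Fin m → (Fin n → ℝ) → Finset (Fin n)) (c : Fin n → ℝ)
    (p : Fin n → ℝ) : Prop :=
  (∀ i, 0 ≤ p i) ∧
    ∀ (i : Fin n) (q : ℝ), 0 ≤ q →
      profit D c (Function.update p i q) i ≤ profit D c p i

/-- `ε`-Nash equilibrium: no seller gains more than `ε` by deviating. -/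
def IsEpsNE {n m : ℕ} (D : Fin m → (Fin n → ℝ) → Finset (Fin n)) (c : Fin n → ℝ)
    (ε : ℝ) (p : Fin n → ℝ) : Prop :=
  (∀ i, 0 ≤ p i) ∧
    ∀ (i : Fin n) (q : ℝ), 0 ≤ q →
      profit D c (Function.update p i q) i ≤ profit D c p i + ε

/-- Market clearing: every buyer purchases every item. -/
def MarketClearing {n m : ℕ} (D : Fin m → (Fin n → ℝ) → Finset (Fin n))
    (p : Fin n → ℝ) : Prop :=
  ∀ j : Fin m, D j p = Finset.univ

/-- `vmarg v j i = v_j(N) - v_j(N \ {i})`. -/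
def vmarg {n m : ℕ} (v : Fin m → Finset (Fin n) → ℝ) (j : Fin m) (i : Fin n) : ℝ :=
  v j Finset.univ - v j (Finset.univ.erase i)

/-- Social welfare of the allocation induced by prices `p`. -/
def SW {n m : ℕ} (v : Fin m → Finset (Fin n) → ℝ)
    (D : Fin m → (Fin n → ℝ) → Finset (Fin n)) (c : Fin n → ℝ)
    (p : Fin n → ℝ) : ℝ :=
  ∑ j : Fin m, (v j (D j p) - ∑ i ∈ D j p, c i)

/-- Under submodularity, the last-unit marginals of the items of `U` add up to at most the loss
from removing `U` from the grand bundle. -/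
theorem IsValuation.sum_marginal_le {n : ℕ} {v : Finset (Fin n) → ℝ} (hv : IsValuation v)
    (U : Finset (Fin n)) :
    ∑ i ∈ U, (v univ - v (univ.erase i)) ≤ v univ - v Uᶜ := by
  induction U using Finset.induction_on with
  | empty => simp
  | insert a U ha ih =>
    rw [Finset.sum_insert ha]
    have h := hv.2.2.2 (insert a U)ᶜ (univ.erase a) a
      (by intro x hx; simp at hx ⊢; exact hx.1) (by simp)
    have hU : insert a (insert a U)ᶜ = Uᶜ := by
      ext x
      by_cases hx : x = a
      · simp [hx, ha]
      · simp [hx]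
    rw [hU, Finset.insert_erase (mem_univ a)] at h
    linarith

/-- If every item outside `S` costs at most its last-unit marginal, then the grand bundle is
weakly better than `S`. -/
theorem IsValuation.util_le_util_univ {n : ℕ} {v : Finset (Fin n) → ℝ} (hv : IsValuation v)
    {p : Fin n → ℝ} {S : Finset (Fin n)}
    (hp : ∀ i ∉ S, p i ≤ v univ - v (univ.erase i)) :
    util v p S ≤ util v p univ := by
  have h1 := hv.sum_marginal_le Sᶜ
  have h2 : ∑ i ∈ Sᶜ, p i ≤ ∑ i ∈ Sᶜ, (v univ - v (univ.erase i)) :=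
    Finset.sum_le_sum fun i hi => hp i (by simpa using hi)
  have h3 := Finset.sum_add_sum_compl S p
  rw [compl_compl] at h1
  unfold util
  linarith

theorem util_erase {n : ℕ} (v : Finset (Fin n) → ℝ) (p : Fin n → ℝ) (i : Fin n) :
    util v p (univ.erase i) = util v p univ - (v univ - v (univ.erase i) - p i) := by
  have h := Finset.add_sum_erase univ p (mem_univ i)
  unfold util
  linarith

/-- The grand bundle is demanded exactly when every item costs at most its last-unit marginal. -/
theorem IsDemandMap.eq_univ_iff {n : ℕ} {v : Finset (Fin n) → ℝ}
    {D : (Fin n → ℝ) → Finset (Fin n)} (hD : IsDemandMap v D) (hv : IsValuation v)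
    (p : Fin n → ℝ) :
    D p = univ ↔ ∀ i, p i ≤ v univ - v (univ.erase i) := by
  constructor
  · intro h i
    have h1 := (hD p).1 (univ.erase i)
    rw [h, util_erase] at h1
    linarith
  · intro h
    have h1 := (hD p).2 univ
      (le_antisymm ((hD p).1 univ) (hv.util_le_util_univ fun i _ => h i))
    exact (Finset.card_eq_iff_eq_univ _).1 (le_antisymm (card_le_univ _) h1)

/-- When all other items cost at most their last-unit marginals, item `i` is demanded at price `q`
exactly when `q` is at most its own last-unit marginal. -/
theorem IsDemandMap.mem_update_iff {n : ℕ} {v : Finset (Fin n) → ℝ}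
    {D : (Fin n → ℝ) → Finset (Fin n)} (hD : IsDemandMap v D) (hv : IsValuation v)
    {p : Fin n → ℝ} (hp : ∀ i, p i ≤ v univ - v (univ.erase i)) (i : Fin n) (q : ℝ) :
    i ∈ D (Function.update p i q) ↔ q ≤ v univ - v (univ.erase i) := by
  have key : ∀ k ≠ i, Function.update p i q k ≤ v univ - v (univ.erase k) := fun k hk => by
    rw [Function.update_of_ne hk]
    exact hp k
  constructor
  · intro h
    have h1 := hv.util_le_util_univ (p := Function.update p i q)
      (S := D (Function.update p i q)) fun k hk => key k (by rintro rfl; exact hk h)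
    have h2 := (hD (Function.update p i q)).1 (univ.erase i)
    rw [util_erase, Function.update_self] at h2
    linarith
  · intro h
    rw [(hD.eq_univ_iff hv _).2 fun k => ?_]
    · exact mem_univ i
    · by_cases hk : k = i
      · subst hk
        simpa using h
      · exact key k hk

theorem marketClearing_iff {n m : ℕ} {v : Fin m → Finset (Fin n) → ℝ}
    {D : Fin m → (Fin n → ℝ) → Finset (Fin n)} (hv : ∀ j, IsValuation (v j))
    (hD : ∀ j, IsDemandMap (v j) (D j)) (p : Fin n → ℝ) :
    MarketClearing D p ↔ ∀ j i, p i ≤ vmarg v j i :=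
  forall_congr' fun j => (hD j).eq_univ_iff (hv j) p

/-- Profit of a unilateral deviation from market clearing prices. -/
theorem profit_update {n m : ℕ} {v : Fin m → Finset (Fin n) → ℝ}
    {D : Fin m → (Fin n → ℝ) → Finset (Fin n)} (hv : ∀ j, IsValuation (v j))
    (hD : ∀ j, IsDemandMap (v j) (D j)) (c : Fin n → ℝ) {p : Fin n → ℝ}
    (hp : ∀ j i, p i ≤ vmarg v j i) (i : Fin n) (q : ℝ) :
    profit D c (Function.update p i q) i =
      ((univ.filter fun j : Fin m => q ≤ vmarg v j i).card : ℝ) * (q - c i) := by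
  unfold profit
  rw [Function.update_self]
  congr 3
  ext j
  simp only [mem_filter, mem_univ, true_and]
  exact (hD j).mem_update_iff (hv j) (hp j) i q

theorem card_filter_fin_two (P : Fin 2 → Prop) [DecidablePred P] :
    ((univ.filter P).card : ℝ) = (if P 0 then 1 else 0) + (if P 1 then 1 else 0) := by
  rw [Finset.card_filter, Fin.sum_univ_two]
  push_cast
  rfl

theorem vmarg_nonneg {n m : ℕ} {v : Fin m → Finset (Fin n) → ℝ}
    (hv : ∀ j, IsValuation (v j)) (j : Fin m) (i : Fin n) : 0 ≤ vmarg v j i :=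
  sub_nonneg.2 ((hv j).2.2.1 _ _ (subset_univ _))

theorem isPNE_and_marketClearing_iff {n : ℕ}
    {v : Fin 2 → Finset (Fin n) → ℝ} (c : Fin n → ℝ)
    (hv : ∀ j, IsValuation (v j)) {D : Fin 2 → (Fin n → ℝ) → Finset (Fin n)}
    (hD : ∀ j, IsDemandMap (v j) (D j)) (p : Fin n → ℝ) :
    (IsPNE D c p ∧ MarketClearing D p) ↔
      (∀ i : Fin n,
        (vmarg v 1 i - c i) / 2 ≤ vmarg v 0 i - c i ∧
        vmarg v 0 i - c i ≤ 2 * (vmarg v 1 i - c i) ∧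
        c i ≤ min (vmarg v 0 i) (vmarg v 1 i)) ∧
      p = fun i => min (vmarg v 0 i) (vmarg v 1 i) := by
  rw [marketClearing_iff hv hD]
  have hprofit : (∀ j i, p i ≤ vmarg v j i) → ∀ i q, profit D c (Function.update p i q) i =
      ((if q ≤ vmarg v 0 i then 1 else 0) + (if q ≤ vmarg v 1 i then 1 else 0)) * (q - c i) :=
    fun hp i q => by rw [profit_update hv hD c hp, card_filter_fin_two]
  have hself : (∀ j i, p i ≤ vmarg v j i) → ∀ i, profit D c p i = 2 * (p i - c i) := by
    intro hp i
    have h := hprofit hp i (p i)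
    rw [Function.update_eq_self, if_pos (hp 0 i), if_pos (hp 1 i)] at h
    linarith
  constructor
  · rintro ⟨⟨-, hdev⟩, hp⟩
    have hdev' : ∀ i q, 0 ≤ q →
        ((if q ≤ vmarg v 0 i then 1 else 0) + (if q ≤ vmarg v 1 i then 1 else 0)) * (q - c i)
          ≤ 2 * (p i - c i) := fun i q hq => by
      rw [← hprofit hp, ← hself hp]
      exact hdev i q hq
    have hpmin : ∀ i, p i = min (vmarg v 0 i) (vmarg v 1 i) := by
      intro i
      refine le_antisymm (le_min (hp 0 i) (hp 1 i)) ?_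
      have h := hdev' i _ (le_min (vmarg_nonneg hv 0 i) (vmarg_nonneg hv 1 i))
      rw [if_pos (min_le_left _ _), if_pos (min_le_right _ _)] at h
      linarith
    refine ⟨fun i => ?_, funext hpmin⟩
    have h0 := vmarg_nonneg hv 0 i
    have h1 := vmarg_nonneg hv 1 i
    have ha := hdev' i (vmarg v 0 i + vmarg v 1 i + 1) (by linarith)
    rw [if_neg (by linarith), if_neg (by linarith)] at ha
    have hb := hdev' i _ h0
    have hc := hdev' i _ h1
    have hm := hpmin i
    rw [← hm]
    rw [if_pos le_rfl] at hb hc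
    rcases le_total (vmarg v 0 i) (vmarg v 1 i) with h | h
    · rw [min_eq_left h] at hm
      refine ⟨?_, ?_, ?_⟩ <;> split_ifs at hb hc <;> linarith
    · rw [min_eq_right h] at hm
      refine ⟨?_, ?_, ?_⟩ <;> split_ifs at hb hc <;> linarith
  · rintro ⟨hcond, hpeq⟩
    have hmin : ∀ i, p i = min (vmarg v 0 i) (vmarg v 1 i) := fun i => by rw [hpeq]
    have hp : ∀ j i, p i ≤ vmarg v j i := by
      intro j i
      rw [hmin]
      fin_cases j
      · exact min_le_left _ _
      · exact min_le_right _ _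
    refine ⟨⟨fun i => ?_, fun i q _ => ?_⟩, hp⟩
    · rw [hmin]
      exact le_min (vmarg_nonneg hv 0 i) (vmarg_nonneg hv 1 i)
    · rw [hprofit hp, hself hp]
      obtain ⟨h1, h2, h3⟩ := hcond i
      have hm := hmin i
      rw [← hm] at h3
      rcases le_total (vmarg v 0 i) (vmarg v 1 i) with h | h
      · rw [min_eq_left h] at hm
        split_ifs <;> linarith
      · rw [min_eq_right h] at hm
        split_ifs <;> linarith

/-- with two buyers, a market clearing pure Nash equilibrium
exists iff for every item `i`, `(v_{2,i} - c_i)/2 ≤ v_{1,i} - c_i ≤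
2(v_{2,i} - c_i)` and `min(v_{1,i}, v_{2,i}) ≥ c_i`; moreover, when this
condition holds, the market clearing PNE is unique and given by
`p_i = min(v_{1,i}, v_{2,i})`. -/
theorem twoBuyers_marketClearing_characterization {n : ℕ}
    (v : Fin 2 → Finset (Fin n) → ℝ) (c : Fin n → ℝ)
    (hv : ∀ j, IsValuation (v j)) (hc : ∀ i, 0 ≤ c i)
    (D : Fin 2 → (Fin n → ℝ) → Finset (Fin n))
    (hD : ∀ j, IsDemandMap (v j) (D j)) :
    ((∃ p, IsPNE D c p ∧ MarketClearing D p) ↔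
      ∀ i : Fin n,
        (vmarg v 1 i - c i) / 2 ≤ vmarg v 0 i - c i ∧
        vmarg v 0 i - c i ≤ 2 * (vmarg v 1 i - c i) ∧
        c i ≤ min (vmarg v 0 i) (vmarg v 1 i)) ∧
    ((∀ i : Fin n,
        (vmarg v 1 i - c i) / 2 ≤ vmarg v 0 i - c i ∧
        vmarg v 0 i - c i ≤ 2 * (vmarg v 1 i - c i) ∧
        c i ≤ min (vmarg v 0 i) (vmarg v 1 i)) →
      ∀ p, (IsPNE D c p ∧ MarketClearing D p) ↔
        p = fun i => min (vmarg v 0 i) (vmarg v 1 i)) := by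
  simp only [isPNE_and_marketClearing_iff c hv hD]
  exact ⟨⟨fun ⟨_, h, _⟩ => h, fun h => ⟨_, h, rfl⟩⟩, fun h _ => and_iff_right h⟩
end

section
/- If there exists an item i ∈ N with min_{j∈M} v_{j,i} < c_i, then for every family of demand maps D_1,…,D_m as in the model, no market clearing pure Nash equilibrium exists. -/
open Finset

/-- A buyer who demands every item pays at most the marginal value of each item. -/
lemma IsDemandMap.le_marginal_of_eq_univ {n : ℕ} {v : Finset (Fin n) → ℝ}
    {D : (Fin n → ℝ) → Finset (Fin n)} (hD : IsDemandMap v D) {p : Fin n → ℝ}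
    (hp : D p = Finset.univ) (i : Fin n) :
    p i ≤ v Finset.univ - v (Finset.univ.erase i) := by
  have h := (hD p).1 (Finset.univ.erase i)
  rw [hp] at h
  simp only [util] at h
  linarith [Finset.add_sum_erase Finset.univ p (Finset.mem_univ i)]

/-- if some item `i` has `min_j v_{j,i} < c_i`, then no market
clearing pure Nash equilibrium exists. -/
theorem no_marketClearing_of_cost_above_min_marginal {n m : ℕ}
    (v : Fin m → Finset (Fin n) → ℝ) (c : Fin n → ℝ)
    (hv : ∀ j, IsValuation (v j)) (hc : ∀ i, 0 ≤ c i)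
    (i : Fin n) (j : Fin m) (hij : vmarg v j i < c i)
    (D : Fin m → (Fin n → ℝ) → Finset (Fin n))
    (hD : ∀ j, IsDemandMap (v j) (D j)) :
    ¬ ∃ p, IsPNE D c p ∧ MarketClearing D p := by
  rintro ⟨p, hp, hclear⟩
  have hlt : p i < c i := ((hD j).le_marginal_of_eq_univ (hclear j) i).trans_lt hij
  have hm : (0 : ℝ) < m := by exact_mod_cast j.pos
  have hprofit : profit D c p i = m * (p i - c i) := by
    have hall : ∀ j, D j p = Finset.univ := hclear
    simp [profit, hall]
  have hdev : profit D c (Function.update p i (c i)) i = 0 := by simp [profit]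
  have hle := hp.2 i (c i) (hc i)
  rw [hdev, hprofit] at hle
  exact absurd hle (not_le.mpr (mul_neg_of_pos_of_neg hm (sub_neg.mpr hlt)))
end

section
/- If there exist an item i ∈ N and an index j ∈ {1,…,m} such that v_{π_i(j),i} − c_i > (m/(m−j+1)) · (v_{π_i(1),i} − c_i), then for every family of demand maps D_1,…,D_m as in the model, no market clearing pure Nash equilibrium exists. -/
open Finset

/-- An item priced at most at its marginal value relative to the full bundle is demanded. -/
lemma IsDemandMap.mem_of_price_le {n : ℕ} {v : Finset (Fin n) → ℝ}
    {D : (Fin n → ℝ) → Finset (Fin n)} (hD : IsDemandMap v D) (hv : IsValuation v)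
    {p : Fin n → ℝ} {i : Fin n} (hp : p i ≤ v univ - v (univ.erase i)) : i ∈ D p := by
  by_contra hi
  have hsub : D p ⊆ univ.erase i := fun x hx =>
    mem_erase.2 ⟨fun h => hi (h ▸ hx), mem_univ x⟩
  have hmarg := hv.2.2.2 _ _ i hsub (notMem_erase i univ)
  rw [insert_erase (mem_univ i)] at hmarg
  have hle := (hD p).1 (insert i (D p))
  have hge : util v p (D p) ≤ util v p (insert i (D p)) := by
    unfold util
    rw [sum_insert hi]
    linarith
  have hcard := (hD p).2 _ (le_antisymm hle hge)
  rw [card_insert_of_notMem hi] at hcard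
  omega

/-- If the full bundle is demanded, every item is priced at most at its marginal value. -/
lemma IsDemandMap.price_le_of_eq_univ {n : ℕ} {v : Finset (Fin n) → ℝ}
    {D : (Fin n → ℝ) → Finset (Fin n)} (hD : IsDemandMap v D)
    {p : Fin n → ℝ} (hp : D p = univ) (i : Fin n) : p i ≤ v univ - v (univ.erase i) := by
  have h := (hD p).1 (univ.erase i)
  rw [hp] at h
  unfold util at h
  have hsum := add_sum_erase univ p (mem_univ i)
  linarith

/-- At least `m - j` indices satisfy a predicate that holds at `σ k` for all `k ≥ j`. -/
lemma sub_le_card_filter_of_perm {m : ℕ} (σ : Equiv.Perm (Fin m)) (j : Fin m)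
    (P : Fin m → Prop) [DecidablePred P] (hP : ∀ k, j ≤ k → P (σ k)) :
    (m : ℝ) - (j.val : ℝ) ≤ ((univ.filter P).card : ℝ) := by
  have hsub : (Ici j).map σ.toEmbedding ⊆ univ.filter P := by
    intro x hx
    obtain ⟨k, hk, rfl⟩ := mem_map.1 hx
    exact mem_filter.2 ⟨mem_univ _, hP k (mem_Ici.1 hk)⟩
  have hcard := card_le_card hsub
  rw [card_map, Fin.card_Ici, Nat.sub_le_iff_le_add] at hcard
  rw [sub_le_iff_le_add]
  exact_mod_cast hcard

/-- if for some item `i` and some (1-based) index `j+1` one has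
`v_{π_i(j+1),i} - c_i > (m/(m-j)) (v_{π_i(1),i} - c_i)`, then no market
clearing pure Nash equilibrium exists. Here `π i` sorts the buyers in
non-decreasing order of the marginal values `v_{·,i}`. -/
theorem no_marketClearing_of_sorted_condition_violated {n m : ℕ} (hm : 0 < m)
    (v : Fin m → Finset (Fin n) → ℝ) (c : Fin n → ℝ)
    (hv : ∀ j, IsValuation (v j)) (hc : ∀ i, 0 ≤ c i)
    (π : Fin n → Equiv.Perm (Fin m))
    (hπ : ∀ (i : Fin n) (j k : Fin m), j ≤ k → vmarg v (π i j) i ≤ vmarg v (π i k) i)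
    (i : Fin n) (j : Fin m)
    (hij : (m : ℝ) / ((m : ℝ) - (j.val : ℝ)) * (vmarg v (π i ⟨0, hm⟩) i - c i)
      < vmarg v (π i j) i - c i)
    (D : Fin m → (Fin n → ℝ) → Finset (Fin n))
    (hD : ∀ j, IsDemandMap (v j) (D j)) :
    ¬ ∃ p, IsPNE D c p ∧ MarketClearing D p := by
  rintro ⟨p, ⟨-, hdev⟩, hclear⟩
  have hprofit : profit D c p i = m * (p i - c i) := by
    simp [profit, hclear _]
  have hm' : (0 : ℝ) < m := by exact_mod_cast hm
  have hj : (0 : ℝ) < (m : ℝ) - (j.val : ℝ) := by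
    rw [sub_pos]
    exact_mod_cast j.isLt
  have hp : p i ≤ vmarg v (π i ⟨0, hm⟩) i := (hD _).price_le_of_eq_univ (hclear _) i
  have hcost : 0 ≤ p i - c i := by
    have h := hdev i (c i) (hc i)
    rw [hprofit] at h
    simp only [profit, Function.update_self, sub_self, mul_zero] at h
    exact nonneg_of_mul_nonneg_right h hm'
  have hq : 0 ≤ vmarg v (π i j) i := sub_nonneg.2 ((hv _).2.2.1 _ _ (erase_subset _ _))
  have hbuyers := sub_le_card_filter_of_perm (π i) j
    (fun k => i ∈ D k (Function.update p i (vmarg v (π i j) i))) fun k hk =>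
      (hD _).mem_of_price_le (hv _) (by
        rw [Function.update_self]
        exact hπ i j k hk)
  have h := hdev i _ hq
  rw [hprofit, profit, Function.update_self] at h
  rw [div_mul_eq_mul_div, div_lt_iff₀ hj] at hij
  have hmargin : 0 < vmarg v (π i j) i - c i :=
    pos_of_mul_pos_left (lt_of_le_of_lt (mul_nonneg hm'.le (by linarith)) hij) hj.le
  have hrevenue := mul_le_mul_of_nonneg_right hbuyers hmargin.le
  have hbound : (m : ℝ) * (p i - c i) ≤ m * (vmarg v (π i ⟨0, hm⟩) i - c i) :=
    mul_le_mul_of_nonneg_left (by linarith) hm'.le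
  linarith
end

section
/- Suppose that for every item i ∈ N and every j ∈ {1,…,m}: v_{π_i(j),i} − c_i ≤ (m/(m−j+1)) · (v_{π_i(1),i} − c_i), and that v_{π_i(1),i} ≥ c_i for every i ∈ N. Then for every family of demand maps D_1,…,D_m as in the model, the price vector p given by p_i = v_{π_i(1),i} = min_{j∈M} v_{j,i} is a market clearing pure Nash equilibrium, and it is the unique market clearing pure Nash equilibrium. -/
open Finset

/-- An item priced at most its marginal value to the full bundle is always demanded. -/
theorem IsDemandMap.mem_of_le {n : ℕ} {v : Finset (Fin n) → ℝ}
    {D : (Fin n → ℝ) → Finset (Fin n)} (hD : IsDemandMap v D) (hv : IsValuation v)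
    {p : Fin n → ℝ} {i : Fin n} (h : p i ≤ v univ - v (univ.erase i)) : i ∈ D p := by
  by_contra hi
  have hsub : D p ⊆ univ.erase i := fun x hx =>
    mem_erase.2 ⟨fun hxi => hi (hxi ▸ hx), mem_univ x⟩
  have hmarg := hv.2.2.2 _ _ i hsub (notMem_erase i univ)
  rw [insert_erase (mem_univ i)] at hmarg
  have hge : util v p (D p) ≤ util v p (insert i (D p)) := by
    simp only [util, sum_insert hi]
    linarith
  have hcard := (hD p).2 _ (le_antisymm ((hD p).1 _) hge)
  rw [card_insert_of_notMem hi] at hcard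
  omega

/-- When the full bundle is demanded, no price exceeds the marginal value of its item. -/
theorem IsDemandMap.le_of_eq_univ {n : ℕ} {v : Finset (Fin n) → ℝ}
    {D : (Fin n → ℝ) → Finset (Fin n)} (hD : IsDemandMap v D)
    {p : Fin n → ℝ} (h : D p = univ) (i : Fin n) : p i ≤ v univ - v (univ.erase i) := by
  have hmax := (hD p).1 (univ.erase i)
  have hsum := add_sum_erase univ p (mem_univ i)
  rw [h] at hmax
  simp only [util] at hmax
  linarith

/-- If all other prices are at most the marginal values, an item is demanded only at a price
that does not exceed its own marginal value. -/
theorem IsDemandMap.le_of_mem {n : ℕ} {v : Finset (Fin n) → ℝ}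
    {D : (Fin n → ℝ) → Finset (Fin n)} (hD : IsDemandMap v D) (hv : IsValuation v)
    {p : Fin n → ℝ} {i : Fin n} (h : ∀ k ≠ i, p k ≤ v univ - v (univ.erase k))
    (hi : i ∈ D p) : p i ≤ v univ - v (univ.erase i) := by
  refine hD.le_of_eq_univ (eq_univ_iff_forall.2 fun k => ?_) i
  by_cases hk : k = i
  · exact hk ▸ hi
  · exact hD.mem_of_le hv (h k hk)

/-- If every buyer demands item `i`, its seller sells all `m` copies. -/
theorem profit_eq_of_forall_mem {n m : ℕ} {D : Fin m → (Fin n → ℝ) → Finset (Fin n)}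
    {c p : Fin n → ℝ} {i : Fin n} (h : ∀ j, i ∈ D j p) :
    profit D c p i = m * (p i - c i) := by
  simp [profit, h]

/-- If the `j`-th value of `a` in the order `σ` exceeds `c` by at most `B / (m - j)`, then selling at price
`q` to a set of buyers whose values are at least `q` yields profit at most `B`. -/
theorem card_mul_sub_le_of_enumeration {m : ℕ} {a : Fin m → ℝ} (σ : Equiv.Perm (Fin m))
    {c B q : ℝ} (hB : 0 ≤ B)
    (hcond : ∀ j : Fin m, ((m : ℝ) - j.val) * (a (σ j) - c) ≤ B)
    {s : Finset (Fin m)} (hs : ∀ j ∈ s, q ≤ a j) :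
    (s.card : ℝ) * (q - c) ≤ B := by
  rcases le_total q c with hq | hq
  · exact (mul_nonpos_of_nonneg_of_nonpos (Nat.cast_nonneg _) (sub_nonpos.2 hq)).trans hB
  rcases s.eq_empty_or_nonempty with rfl | hne
  · simpa using hB
  obtain ⟨b, hb, hmin⟩ := exists_min_image s σ.symm hne
  have hcard : s.card ≤ m - (σ.symm b).val := by
    rw [← card_map σ.symm.toEmbedding, ← Fin.card_Ici]
    refine card_le_card fun x hx => ?_
    obtain ⟨y, hy, rfl⟩ := mem_map.1 hx
    exact mem_Ici.2 (hmin y hy)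
  have hcard' : (s.card : ℝ) ≤ (m : ℝ) - (σ.symm b).val := by
    rw [← Nat.cast_sub (σ.symm b).isLt.le]
    exact_mod_cast hcard
  have hbound := hcond (σ.symm b)
  rw [Equiv.apply_symm_apply] at hbound
  have hqb := hs b hb
  calc (s.card : ℝ) * (q - c) ≤ ((m : ℝ) - (σ.symm b).val) * (a b - c) := by
        gcongr
        exact (Nat.cast_nonneg _).trans hcard'
    _ ≤ B := hbound

/-- if for every item `i` and every (1-based) index `j+1`,
`v_{π_i(j+1),i} - c_i ≤ (m/(m-j)) (v_{π_i(1),i} - c_i)` and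
`v_{π_i(1),i} ≥ c_i`, then `p_i = v_{π_i(1),i} = min_j v_{j,i}` is a market
clearing pure Nash equilibrium, and it is the unique one. -/
theorem marketClearing_exists_unique_of_sorted_condition {n m : ℕ} (hm : 0 < m)
    (v : Fin m → Finset (Fin n) → ℝ) (c : Fin n → ℝ)
    (hv : ∀ j, IsValuation (v j)) (hc : ∀ i, 0 ≤ c i)
    (π : Fin n → Equiv.Perm (Fin m))
    (hπ : ∀ (i : Fin n) (j k : Fin m), j ≤ k → vmarg v (π i j) i ≤ vmarg v (π i k) i)
    (hcond : ∀ (i : Fin n) (j : Fin m),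
      vmarg v (π i j) i - c i ≤
        (m : ℝ) / ((m : ℝ) - (j.val : ℝ)) * (vmarg v (π i ⟨0, hm⟩) i - c i))
    (hci : ∀ i : Fin n, c i ≤ vmarg v (π i ⟨0, hm⟩) i)
    (D : Fin m → (Fin n → ℝ) → Finset (Fin n))
    (hD : ∀ j, IsDemandMap (v j) (D j)) :
    (∀ (i : Fin n) (j : Fin m), vmarg v (π i ⟨0, hm⟩) i ≤ vmarg v j i) ∧
    IsPNE D c (fun i => vmarg v (π i ⟨0, hm⟩) i) ∧
    MarketClearing D (fun i => vmarg v (π i ⟨0, hm⟩) i) ∧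
    ∀ p, IsPNE D c p ∧ MarketClearing D p →
      p = fun i => vmarg v (π i ⟨0, hm⟩) i := by
  have hmin : ∀ (i : Fin n) (j : Fin m), vmarg v (π i ⟨0, hm⟩) i ≤ vmarg v j i := fun i j => by
    simpa using hπ i ⟨0, hm⟩ ((π i).symm j) (Nat.zero_le _)
  have hmem : ∀ i j, i ∈ D j fun i => vmarg v (π i ⟨0, hm⟩) i := fun i j =>
    (hD j).mem_of_le (hv j) (hmin i j)
  refine ⟨hmin, ⟨fun i => (hc i).trans (hci i), fun i q _ => ?_⟩,
    fun j => eq_univ_iff_forall.2 fun i => hmem i j, fun p hp => funext fun i => ?_⟩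
  · rw [profit_eq_of_forall_mem (hmem i), profit, Function.update_self]
    refine card_mul_sub_le_of_enumeration (a := fun j => vmarg v j i) (π i)
      (mul_nonneg (Nat.cast_nonneg _) (sub_nonneg.2 (hci i))) (fun j => ?_) fun j hj => ?_
    · have hpos : (0 : ℝ) < (m : ℝ) - j.val := sub_pos.2 (Nat.cast_lt.2 j.isLt)
      have h := hcond i j
      rwa [div_mul_eq_mul_div, le_div_iff₀' hpos] at h
    · have h := (hD j).le_of_mem (hv j) (fun k hk => ?_) (mem_filter.1 hj).2
      · rwa [Function.update_self] at h
      · rw [Function.update_of_ne hk]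
        exact hmin k j
  · refine le_antisymm ((hD _).le_of_eq_univ (hp.2 _) i) ?_
    have hdev := hp.1.2 i (vmarg v (π i ⟨0, hm⟩) i) ((hc i).trans (hci i))
    rw [profit_eq_of_forall_mem fun j => (hD j).mem_of_le (hv j) ?_,
      profit_eq_of_forall_mem fun j => hp.2 j ▸ mem_univ i, Function.update_self] at hdev
    · exact (sub_le_sub_iff_right _).1 (le_of_mul_le_mul_left hdev (Nat.cast_pos.2 hm))
    · rw [Function.update_self]
      exact hmin i j
end

section
/- Suppose m = 2, buyer 1's valuation v_1 is submodular (normalized and monotone), buyer 2's valuation v_2 is additive, and for every item i ∈ N: (v_{2,i} − c_i)/2 < v_{1,i} − c_i < 2(v_{2,i} − c_i) and min{v_{1,i}, v_{2,i}} > c_i. Then for every family of demand maps D_1, D_2 as in the model there is exactly one pure Nash equilibrium, it is market clearing, and it is given by p_i = min{v_{1,i}, v_{2,i}} for all i ∈ N. -/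
open Finset

lemma IsDemandMap.mem_of_le_marginal {n : ℕ} {v : Finset (Fin n) → ℝ}
    {D : (Fin n → ℝ) → Finset (Fin n)} (hv : IsValuation v) (hD : IsDemandMap v D)
    {p : Fin n → ℝ} {i : Fin n} (h : p i ≤ v univ - v (univ.erase i)) : i ∈ D p := by
  by_contra hi
  have hsub := hv.2.2.2 (D p) (univ.erase i) i
    (fun x hx => mem_erase.2 ⟨fun e => hi (e ▸ hx), mem_univ x⟩) (notMem_erase i univ)
  rw [insert_erase (mem_univ i)] at hsub
  have hu : util v p (insert i (D p)) = v (insert i (D p)) - p i - ∑ x ∈ D p, p x := by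
    rw [util, sum_insert hi]; ring
  have hle : util v p (D p) ≤ util v p (insert i (D p)) := by
    rw [hu, util]; linarith
  have hcard := (hD p).2 _ (le_antisymm ((hD p).1 _) hle)
  rw [card_insert_of_notMem hi] at hcard
  omega

lemma IsDemandMap.price_le_marginal {n : ℕ} {v : Finset (Fin n) → ℝ}
    {D : (Fin n → ℝ) → Finset (Fin n)} (hD : IsDemandMap v D)
    {p : Fin n → ℝ} {i : Fin n} (hi : i ∈ D p) : p i ≤ v (D p) - v ((D p).erase i) := by
  have h := (hD p).1 ((D p).erase i)
  have hs := add_sum_erase (D p) p hi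
  unfold util at h
  linarith

lemma IsAdditive.sub_erase {n : ℕ} {v : Finset (Fin n) → ℝ} (h : IsAdditive v)
    {S : Finset (Fin n)} {i : Fin n} (hi : i ∈ S) : v S - v (S.erase i) = v {i} := by
  rw [h S, h (S.erase i), ← add_sum_erase S (fun x => v {x}) hi]
  ring

lemma IsDemandMap.mem_iff_of_isAdditive {n : ℕ} {v : Finset (Fin n) → ℝ}
    {D : (Fin n → ℝ) → Finset (Fin n)} (hv : IsValuation v) (ha : IsAdditive v)
    (hD : IsDemandMap v D) {p : Fin n → ℝ} {i : Fin n} :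
    i ∈ D p ↔ p i ≤ v univ - v (univ.erase i) := by
  refine ⟨fun hi => ?_, hD.mem_of_le_marginal hv⟩
  rw [ha.sub_erase (mem_univ i), ← ha.sub_erase hi]
  exact hD.price_le_marginal hi

lemma profit_two_buyers {n : ℕ} (D : Fin 2 → (Fin n → ℝ) → Finset (Fin n)) (c p : Fin n → ℝ)
    (i : Fin n) :
    profit D c p i =
      ((if i ∈ D 0 p then 1 else 0) + (if i ∈ D 1 p then 1 else 0)) * (p i - c i) := by
  rw [profit, card_filter, Fin.sum_univ_two]
  push_cast
  rfl

/-- two buyers, buyer 1 submodular, buyer 2 additive, with the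
strict conditions `(v_{2,i}-c_i)/2 < v_{1,i}-c_i < 2(v_{2,i}-c_i)` and
`min(v_{1,i},v_{2,i}) > c_i` for every item. Then there is exactly one pure
Nash equilibrium, given by `p_i = min(v_{1,i}, v_{2,i})`, and it is market
clearing. -/
theorem twoBuyers_unique_PNE_submodular_additive {n : ℕ}
    (v : Fin 2 → Finset (Fin n) → ℝ) (c : Fin n → ℝ)
    (hv : ∀ j, IsValuation (v j)) (hadd : IsAdditive (v 1)) (hc : ∀ i, 0 ≤ c i)
    (hcond : ∀ i : Fin n,
      (vmarg v 1 i - c i) / 2 < vmarg v 0 i - c i ∧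
      vmarg v 0 i - c i < 2 * (vmarg v 1 i - c i) ∧
      c i < min (vmarg v 0 i) (vmarg v 1 i))
    (D : Fin 2 → (Fin n → ℝ) → Finset (Fin n))
    (hD : ∀ j, IsDemandMap (v j) (D j)) :
    (∀ p, IsPNE D c p ↔ p = fun i => min (vmarg v 0 i) (vmarg v 1 i)) ∧
    MarketClearing D (fun i => min (vmarg v 0 i) (vmarg v 1 i)) := by
  have hmem0 : ∀ p i, p i ≤ vmarg v 0 i → i ∈ D 0 p := fun p i h =>
    (hD 0).mem_of_le_marginal (hv 0) h
  have hmem1 : ∀ p i, i ∈ D 1 p ↔ p i ≤ vmarg v 1 i := fun p i =>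
    (hD 1).mem_iff_of_isAdditive (hv 1) hadd
  have hprice0 : ∀ p i, D 0 p = univ → p i ≤ vmarg v 0 i := fun p i h => by
    have := (hD 0).price_le_marginal (p := p) (i := i) (h ▸ mem_univ i)
    rwa [h] at this
  have hclear : ∀ i, i ∈ D 0 (fun i => min (vmarg v 0 i) (vmarg v 1 i)) ∧
      i ∈ D 1 (fun i => min (vmarg v 0 i) (vmarg v 1 i)) := fun i =>
    ⟨hmem0 _ _ (min_le_left _ _), (hmem1 _ _).2 (min_le_right _ _)⟩
  refine ⟨fun p => ⟨fun ⟨_, hp⟩ => ?_, ?_⟩, ?_⟩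
  · have hdev : ∀ i, 2 * (min (vmarg v 0 i) (vmarg v 1 i) - c i) ≤ profit D c p i := fun i => by
      have h := hp i (min (vmarg v 0 i) (vmarg v 1 i)) ((hc i).trans (hcond i).2.2.le)
      rw [profit_two_buyers, if_pos (hmem0 _ _ (by simp)),
        if_pos ((hmem1 _ _).2 (by simp)), Function.update_self] at h
      linarith
    have hall : D 0 p = univ := by
      refine eq_univ_of_forall fun i => ?_
      by_contra hi
      have h := hdev i
      obtain ⟨h1, h2, h3⟩ := hcond i
      rw [profit_two_buyers, if_neg hi] at h
      split_ifs at h with hi1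
      · have := (hmem1 p i).1 hi1
        rcases min_cases (vmarg v 0 i) (vmarg v 1 i) with ⟨e, _⟩ | ⟨e, _⟩ <;>
          rw [e] at h h3 <;> linarith
      · linarith
    funext i
    have h := hdev i
    obtain ⟨h1, h2, h3⟩ := hcond i
    have h0 := hprice0 p i hall
    rw [profit_two_buyers, if_pos (hall ▸ mem_univ i)] at h
    split_ifs at h with hi1
    · exact le_antisymm (le_min h0 ((hmem1 p i).1 hi1)) (by linarith)
    · exfalso
      rcases min_cases (vmarg v 0 i) (vmarg v 1 i) with ⟨e, _⟩ | ⟨e, _⟩ <;>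
        rw [e] at h h3 <;> linarith
  · rintro rfl
    refine ⟨fun i => (hc i).trans (hcond i).2.2.le, fun i q _ => ?_⟩
    set P := Function.update (fun i => min (vmarg v 0 i) (vmarg v 1 i)) i q with hP
    have hPi : P i = q := by simp [hP]
    have hbuy0 : i ∈ D 0 P → q ≤ vmarg v 0 i := fun hi => by
      refine hPi ▸ hprice0 P i (eq_univ_of_forall fun k => ?_)
      by_cases hk : k = i
      · exact hk ▸ hi
      · exact hmem0 _ _ (by simp [hP, hk])
    have hbuy1 : i ∈ D 1 P → q ≤ vmarg v 1 i := fun hi => hPi ▸ (hmem1 P i).1 hi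
    obtain ⟨h1, h2, h3⟩ := hcond i
    rw [profit_two_buyers D c P, profit_two_buyers, if_pos (hclear i).1, if_pos (hclear i).2, hPi]
    split_ifs with hi0 hi1 hi1
    · linarith [le_min (hbuy0 hi0) (hbuy1 hi1)]
    · have := hbuy0 hi0
      rcases min_cases (vmarg v 0 i) (vmarg v 1 i) with ⟨e, _⟩ | ⟨e, _⟩ <;>
        rw [e] at h3 ⊢ <;> linarith
    · have := hbuy1 hi1
      rcases min_cases (vmarg v 0 i) (vmarg v 1 i) with ⟨e, _⟩ | ⟨e, _⟩ <;>
        rw [e] at h3 ⊢ <;> linarith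
    · linarith
  · intro j
    refine eq_univ_of_forall fun i => ?_
    fin_cases j
    exacts [(hclear i).1, (hclear i).2]
end

section
/- Suppose all production costs are zero (c_i = 0 for all i ∈ N). Let p be a pure Nash equilibrium and for each buyer j let S_j = D_j(p) be the set buyer j purchases at p. Then ∑_{j∈M} v_j(N) ≤ H_m · ∑_{j∈M} v_j(S_j), where H_m = ∑_{k=1}^{m} 1/k is the m-th harmonic number. -/
open Finset

/-- A valuation never gains more from a set of extra items than the sum of their marginals. -/
theorem IsValuation.union_sub_le_sum_marginals {n : ℕ} {v : Finset (Fin n) → ℝ}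
    (hv : IsValuation v) (S T : Finset (Fin n)) (hST : Disjoint S T) :
    v (S ∪ T) - v S ≤ ∑ i ∈ T, (v (insert i S) - v S) := by
  induction T using Finset.induction_on with
  | empty => simp
  | insert a T ha ih =>
    rw [Finset.disjoint_insert_right] at hST
    have hsub := hv.2.2.2 S (S ∪ T) a subset_union_left (by simp [hST.1, ha])
    rw [Finset.sum_insert ha, Finset.union_insert]
    linarith [ih hST.2]

theorem util_update_of_notMem {n : ℕ} (v : Finset (Fin n) → ℝ) (p : Fin n → ℝ) {i : Fin n}
    (q : ℝ) {T : Finset (Fin n)} (hi : i ∉ T) :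
    util v (Function.update p i q) T = util v p T := by
  rw [util, util, Finset.sum_update_of_notMem hi]

theorem util_update_of_mem {n : ℕ} (v : Finset (Fin n) → ℝ) (p : Fin n → ℝ) {i : Fin n}
    (q : ℝ) {T : Finset (Fin n)} (hi : i ∈ T) :
    util v (Function.update p i q) T = util v p T + p i - q := by
  rw [util, util, Finset.sum_update_of_mem hi, Finset.sdiff_singleton_eq_erase,
    ← Finset.add_sum_erase T p hi]
  ring

theorem util_insert {n : ℕ} (v : Finset (Fin n) → ℝ) (p : Fin n → ℝ) {i : Fin n}
    {S : Finset (Fin n)} (hi : i ∉ S) :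
    util v p (insert i S) = util v p S + (v (insert i S) - v S) - p i := by
  rw [util, util, Finset.sum_insert hi]
  ring

/-- An item left unbought has marginal value strictly below its price. -/
theorem IsDemandMap.marginal_lt_price {n : ℕ} {v : Finset (Fin n) → ℝ}
    {D : (Fin n → ℝ) → Finset (Fin n)} (hD : IsDemandMap v D) {p : Fin n → ℝ} {i : Fin n}
    (hi : i ∉ D p) : v (insert i (D p)) - v (D p) < p i := by
  by_contra! h
  have hins := util_insert v p hi
  have hcard := (hD p).2 (insert i (D p)) (le_antisymm ((hD p).1 _) (by linarith))
  rw [Finset.card_insert_of_notMem hi] at hcard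
  omega

/-- A buyer keeps an item whose price decreases. -/
theorem IsDemandMap.mem_of_price_lt {n : ℕ} {v : Finset (Fin n) → ℝ}
    {D : (Fin n → ℝ) → Finset (Fin n)} (hD : IsDemandMap v D) {p : Fin n → ℝ} {i : Fin n}
    {q : ℝ} (hi : i ∈ D p) (hq : q < p i) : i ∈ D (Function.update p i q) := by
  by_contra h
  have h1 := (hD (Function.update p i q)).1 (D p)
  rw [util_update_of_mem v p q hi, util_update_of_notMem v p q h] at h1
  linarith [(hD p).1 (D (Function.update p i q))]

/-- A buyer starts buying an item once its price is at most its marginal value. -/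
theorem IsDemandMap.mem_of_price_le_marginal {n : ℕ} {v : Finset (Fin n) → ℝ}
    {D : (Fin n → ℝ) → Finset (Fin n)} (hD : IsDemandMap v D) {p : Fin n → ℝ} {i : Fin n}
    {q : ℝ} (hi : i ∉ D p) (hq : q ≤ v (insert i (D p)) - v (D p)) :
    i ∈ D (Function.update p i q) := by
  by_contra h
  have hopt := hD (Function.update p i q)
  have h1 := hopt.1 (insert i (D p))
  have h2 := hopt.2 (insert i (D p))
  rw [util_update_of_mem v p q (Finset.mem_insert_self _ _), util_insert v p hi,
    util_update_of_notMem v p q h] at h1 h2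
  have h3 := (hD p).1 (D (Function.update p i q))
  have h4 := h2 (by linarith)
  have h5 := (hD p).2 (D (Function.update p i q)) (by linarith)
  rw [Finset.card_insert_of_notMem hi] at h4
  omega

/-- If `f` is nonnegative and each of its upper level sets, offset by `K`, satisfies a revenue
bound `C`, then the sum of `f` is at most `C` times a section of the harmonic series. -/
theorem sum_le_mul_harmonic_of_level_bound {ι : Type*} [DecidableEq ι] (K : ℕ) (C : ℝ)
    (f : ι → ℝ) (s : Finset ι) (hf : ∀ j ∈ s, 0 ≤ f j)
    (h : ∀ j ∈ s, ((K : ℝ) + (s.filter fun j' => f j ≤ f j').card) * f j ≤ C) :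
    ∑ j ∈ s, f j ≤ C * ∑ l ∈ Finset.range s.card, (1 : ℝ) / ((K + l : ℕ) + 1) := by
  induction s using Finset.induction_on_min_value f with
  | empty => simp
  | insert a s ha hmin ih =>
    rw [Finset.sum_insert ha, Finset.card_insert_of_notMem ha, Finset.sum_range_succ, mul_add]
    have hs := ih (fun j hj => hf j (Finset.mem_insert_of_mem hj)) fun j hj => by
      refine le_trans (mul_le_mul_of_nonneg_right ?_ (hf j (Finset.mem_insert_of_mem hj)))
        (h j (Finset.mem_insert_of_mem hj))
      gcongr
      exact Finset.subset_insert a s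
    have hlevel := h a (Finset.mem_insert_self a s)
    rw [Finset.filter_true_of_mem (by simpa using hmin), Finset.card_insert_of_notMem ha]
      at hlevel
    have hfa : f a ≤ C * (1 / (((K + s.card : ℕ) : ℝ) + 1)) := by
      rw [mul_one_div, le_div_iff₀ (by positivity)]
      push_cast at hlevel ⊢
      linarith
    linarith

/-- In equilibrium, the marginal values of the buyers not served by seller `i` sum to at most
`H_m - 1` times the profit of seller `i`. -/
theorem IsPNE.sum_marginals_le {n m : ℕ} {v : Fin m → Finset (Fin n) → ℝ}
    (hv : ∀ j, IsValuation (v j)) {D : Fin m → (Fin n → ℝ) → Finset (Fin n)}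
    (hD : ∀ j, IsDemandMap (v j) (D j)) {p : Fin n → ℝ} (hp : IsPNE D (fun _ => 0) p)
    (i : Fin n) :
    ∑ j with i ∉ D j p, (v j (insert i (D j p)) - v j (D j p)) ≤
      (∑ k ∈ Finset.range m, (1 : ℝ) / (k + 1) - 1) * ∑ j with i ∈ D j p, p i := by
  set K := (univ.filter fun j : Fin m => i ∈ D j p).card with hK
  have hmarg (j : Fin m) : 0 ≤ v j (insert i (D j p)) - v j (D j p) :=
    sub_nonneg.2 ((hv j).2.2.1 _ _ (Finset.subset_insert _ _))
  have hbound := sum_le_mul_harmonic_of_level_bound K (K * p i)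
    (fun j => v j (insert i (D j p)) - v j (D j p))
    (univ.filter fun j : Fin m => i ∉ D j p) (fun j _ => hmarg j) (by
      intro j hj
      simp only [Finset.mem_filter, Finset.mem_univ, true_and] at hj
      set q := v j (insert i (D j p)) - v j (D j p) with hq
      have hqp : q < p i := (hD j).marginal_lt_price hj
      have hdev := hp.2 i q (hmarg j)
      simp only [profit, Function.update_self, sub_zero] at hdev
      refine le_trans (mul_le_mul_of_nonneg_right ?_ (hmarg j)) hdev
      rw [hK, ← Nat.cast_add, ← Finset.card_union_of_disjoint]
      · gcongr
        intro j' hj'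
        simp only [Finset.mem_union, Finset.mem_filter, Finset.mem_univ, true_and] at hj' ⊢
        rcases hj' with hj' | ⟨hj', hle⟩
        · exact (hD j').mem_of_price_lt hj' hqp
        · exact (hD j').mem_of_price_le_marginal hj' hle
      · exact (Finset.disjoint_filter_filter_not _ _ _).mono_right (Finset.filter_subset _ _))
  have hcard : K + (univ.filter fun j : Fin m => i ∉ D j p).card = m := by
    simpa using Finset.card_filter_add_card_filter_not (s := (univ : Finset (Fin m)))
      (fun j => i ∈ D j p)
  have hsplit := Finset.sum_range_add (fun k : ℕ => (1 : ℝ) / (k + 1)) K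
    (univ.filter fun j : Fin m => i ∉ D j p).card
  rw [hcard] at hsplit
  refine hbound.trans ?_
  rw [Finset.sum_const, ← hK, nsmul_eq_mul, mul_comm (_ - _)]
  rcases Nat.eq_zero_or_pos K with h0 | hpos
  · simp [h0]
  · have hone : (1 : ℝ) ≤ ∑ k ∈ Finset.range K, (1 : ℝ) / (k + 1) := by
      simpa using Finset.single_le_sum (f := fun k : ℕ => (1 : ℝ) / (k + 1))
        (fun k _ => by positivity) (Finset.mem_range.2 hpos)
    exact mul_le_mul_of_nonneg_left (by linarith) (mul_nonneg (Nat.cast_nonneg K) (hp.1 i))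

/-- with zero production costs, every pure Nash equilibrium `p`
with induced purchases `S_j = D_j(p)` satisfies
`∑_j v_j(N) ≤ H_m ∑_j v_j(S_j)` where `H_m` is the m-th harmonic number. -/
theorem welfare_harmonic_bound {n m : ℕ}
    (v : Fin m → Finset (Fin n) → ℝ)
    (hv : ∀ j, IsValuation (v j))
    (D : Fin m → (Fin n → ℝ) → Finset (Fin n))
    (hD : ∀ j, IsDemandMap (v j) (D j))
    (p : Fin n → ℝ) (hp : IsPNE D (fun _ => 0) p) :
    ∑ j : Fin m, v j Finset.univ ≤
      (∑ k ∈ Finset.range m, (1 : ℝ) / (k + 1)) * ∑ j : Fin m, v j (D j p) := by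
  have hH : ∑ j : Fin m, v j univ - ∑ j : Fin m, v j (D j p) ≤
      (∑ k ∈ Finset.range m, (1 : ℝ) / (k + 1) - 1) * ∑ j : Fin m, v j (D j p) := by
    rcases Nat.eq_zero_or_pos m with rfl | hm
    · simp
    have hone : (1 : ℝ) ≤ ∑ k ∈ Finset.range m, (1 : ℝ) / (k + 1) := by
      simpa using Finset.single_le_sum (f := fun k : ℕ => (1 : ℝ) / (k + 1))
        (fun k _ => by positivity) (Finset.mem_range.2 hm)
    calc ∑ j : Fin m, v j univ - ∑ j : Fin m, v j (D j p)
        ≤ ∑ j : Fin m, ∑ i with i ∉ D j p, (v j (insert i (D j p)) - v j (D j p)) := by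
          rw [← Finset.sum_sub_distrib]
          refine Finset.sum_le_sum fun j _ => ?_
          have h := (hv j).union_sub_le_sum_marginals (D j p) (D j p)ᶜ disjoint_compl_right
          rw [Finset.union_compl] at h
          exact h.trans_eq (Finset.sum_congr (by ext i; simp) fun _ _ => rfl)
      _ = ∑ i : Fin n, ∑ j with i ∉ D j p, (v j (insert i (D j p)) - v j (D j p)) := by
          simp only [Finset.sum_filter]
          exact Finset.sum_comm
      _ ≤ ∑ i : Fin n, (∑ k ∈ Finset.range m, (1 : ℝ) / (k + 1) - 1) *
            ∑ j with i ∈ D j p, p i :=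
          Finset.sum_le_sum fun i _ => hp.sum_marginals_le hv hD i
      _ = (∑ k ∈ Finset.range m, (1 : ℝ) / (k + 1) - 1) *
            ∑ j : Fin m, ∑ i ∈ D j p, p i := by
          rw [← Finset.mul_sum]
          congr 1
          simp only [Finset.sum_filter]
          rw [Finset.sum_comm]
          simp
      _ ≤ _ := by
          refine mul_le_mul_of_nonneg_left (Finset.sum_le_sum fun j _ => ?_) (by linarith)
          have h := (hD j p).1 ∅
          simp only [util, (hv j).1, Finset.sum_empty] at h
          linarith
  linarith
end

section
/- Fix ε > 0 and consider the instance with a single seller (n = 1, N = {1}), zero production cost, and m additive buyers with v_1({1}) = 1 + ε and v_j({1}) = 1/j for 2 ≤ j ≤ m. Then the price p_1 = 1 + ε is a pure Nash equilibrium (only buyer 1 purchases) whose social welfare is 1 + ε, while the maximum social welfare over all price vectors is H_m + ε, where H_m = ∑_{k=1}^{m} 1/k; consequently the price of anarchy of this instance is at least (H_m + ε)/(1 + ε). -/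
open Finset

/-- With a single item valued at `a`, the item is demanded iff its price is at most `a`. -/
lemma IsDemandMap.mem_iff_price_le {a : ℝ} {v : Finset (Fin 1) → ℝ}
    (hv : ∀ S, v S = (S.card : ℝ) * a) {D : (Fin 1 → ℝ) → Finset (Fin 1)}
    (hD : IsDemandMap v D) (p : Fin 1 → ℝ) (i : Fin 1) : i ∈ D p ↔ p 0 ≤ a := by
  obtain rfl : i = 0 := Subsingleton.elim _ _
  obtain ⟨hmax, hcard⟩ := hD p
  have hcases : ∀ S : Finset (Fin 1), S = ∅ ∨ S = {0} := by decide
  constructor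
  · intro h
    have hS : D p = {0} := (hcases (D p)).resolve_left (Finset.ne_empty_of_mem h)
    have h0 := hmax ∅
    simp only [hS, util, hv, Finset.card_empty, Finset.card_singleton, Finset.sum_empty,
      Finset.sum_singleton, Nat.cast_zero, Nat.cast_one] at h0
    linarith
  · intro h
    by_contra hn
    have hS : D p = ∅ := (hcases (D p)).resolve_right fun h' => hn (by simp [h'])
    have h1 := hmax {0}
    have h2 := hcard {0}
    simp only [hS, util, hv, Finset.card_empty, Finset.card_singleton, Finset.sum_empty,
      Finset.sum_singleton, Nat.cast_zero, Nat.cast_one] at h1 h2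
    have := h2 (by linarith)
    omega

/-- If buyer `j` (counting from zero) values the item at no more than `b / (j + 1)`, then no
price yields revenue above `b`. -/
lemma card_filter_price_le_mul_le {m : ℕ} {b : ℝ} (hb : 0 ≤ b) {val : Fin m → ℝ}
    (hval : ∀ j, val j ≤ b / ((j.val : ℝ) + 1)) {q : ℝ} (hq : 0 ≤ q) :
    ((Finset.univ.filter fun j => q ≤ val j).card : ℝ) * q ≤ b := by
  set s := Finset.univ.filter fun j => q ≤ val j
  rcases s.eq_empty_or_nonempty with h | h
  · simpa [h] using hb
  · obtain ⟨j, hj, hjmax⟩ := s.exists_max_image id h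
    have hsub : s ⊆ Finset.Iic j := fun x hx => Finset.mem_Iic.2 (hjmax x hx)
    have hcard : (s.card : ℝ) ≤ (j.val : ℝ) + 1 := by
      have := Finset.card_le_card hsub
      rw [Fin.card_Iic] at this
      exact_mod_cast this
    have hqj : q ≤ b / ((j.val : ℝ) + 1) :=
      (Finset.mem_filter.1 hj).2.trans (hval j)
    rw [le_div_iff₀ (by positivity)] at hqj
    nlinarith [mul_le_mul_of_nonneg_right hcard hq]

/-- single seller with zero cost, `m` additive buyers where buyer
1 values the item at `1 + ε` and buyer `j` (for `2 ≤ j ≤ m`) at `1/j`. Then the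
price `1 + ε` is a pure Nash equilibrium with social welfare `1 + ε`, while the
maximum social welfare over all (nonnegative) price vectors equals `H_m + ε`;
consequently the price of anarchy of the instance is at least
`(H_m + ε)/(1 + ε)`. -/
theorem singleSeller_harmonic_instance {m : ℕ} (hm : 0 < m) (ε : ℝ) (hε : 0 < ε)
    (val : Fin m → ℝ)
    (hval0 : val ⟨0, hm⟩ = 1 + ε)
    (hvalj : ∀ j : Fin m, 1 ≤ j.val → val j = 1 / ((j.val : ℝ) + 1))
    (v : Fin m → Finset (Fin 1) → ℝ)
    (hv : ∀ j S, v j S = (S.card : ℝ) * val j)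
    (D : Fin m → (Fin 1 → ℝ) → Finset (Fin 1))
    (hD : ∀ j, IsDemandMap (v j) (D j)) :
    IsPNE D (fun _ => 0) (fun _ => 1 + ε) ∧
    SW v D (fun _ => 0) (fun _ => 1 + ε) = 1 + ε ∧
    IsGreatest {w : ℝ | ∃ q : Fin 1 → ℝ, (∀ i, 0 ≤ q i) ∧ SW v D (fun _ => 0) q = w}
      ((∑ k ∈ Finset.range m, (1 : ℝ) / (k + 1)) + ε) ∧
    ((∑ k ∈ Finset.range m, (1 : ℝ) / (k + 1)) + ε) / (1 + ε) ≤
      ((∑ k ∈ Finset.range m, (1 : ℝ) / (k + 1)) + ε) /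
        SW v D (fun _ => 0) (fun _ => 1 + ε) := by
  have hmem : ∀ j p i, i ∈ D j p ↔ p 0 ≤ val j := fun j p i =>
    (hD j).mem_iff_price_le (hv j) p i
  have hcases : ∀ j : Fin m, j = ⟨0, hm⟩ ∨ 1 ≤ j.val := fun j => by
    rw [Fin.ext_iff]; simp only; omega
  have hpos : ∀ j, 0 ≤ val j := fun j => by
    rcases hcases j with rfl | h
    · rw [hval0]; positivity
    · rw [hvalj j h]; positivity
  have hle : ∀ j, val j ≤ (1 + ε) / ((j.val : ℝ) + 1) := fun j => by
    rcases hcases j with rfl | h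
    · simp [hval0]
    · rw [hvalj j h]; gcongr; linarith
  have hbuy : ∀ j, 1 + ε ≤ val j ↔ j = ⟨0, hm⟩ := fun j => by
    refine ⟨fun h => (hcases j).resolve_right fun h1 => ?_, fun h => by rw [h, hval0]⟩
    rw [hvalj j h1, le_div_iff₀ (by positivity)] at h
    have : (1 : ℝ) ≤ j.val := by exact_mod_cast h1
    nlinarith
  have hSW : ∀ p, SW v D (fun _ => 0) p = ∑ j, if p 0 ≤ val j then val j else 0 := fun p => by
    refine Finset.sum_congr rfl fun j _ => ?_
    have hDj : D j p = if p 0 ≤ val j then Finset.univ else ∅ := by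
      ext i
      rw [hmem]
      split_ifs with h <;> simp [h, Subsingleton.elim i 0]
    rw [hDj, hv]
    split_ifs <;> simp
  have hsum : ∑ j, val j = (∑ k ∈ Finset.range m, (1 : ℝ) / (k + 1)) + ε := by
    have h1 : ∀ j : Fin m,
        val j = 1 / ((j.val : ℝ) + 1) + if j = ⟨0, hm⟩ then ε else 0 := fun j => by
      rcases hcases j with rfl | h
      · simp [hval0]
      · have hj : j ≠ ⟨0, hm⟩ := by rintro rfl; simp at h
        rw [hvalj j h, if_neg hj, add_zero]
    rw [Finset.sum_congr rfl fun j _ => h1 j, Finset.sum_add_distrib,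
      Fin.sum_univ_eq_sum_range (fun k => (1 : ℝ) / ((k : ℝ) + 1)) m]
    simp
  have hSWeq : SW v D (fun _ => 0) (fun _ => 1 + ε) = 1 + ε := by
    rw [hSW]
    simp [hbuy, hval0]
  refine ⟨⟨fun _ => by positivity, fun i q hq => ?_⟩, hSWeq, ⟨⟨fun _ => 0, fun _ => le_rfl, ?_⟩, ?_⟩,
    by rw [hSWeq]⟩
  · obtain rfl : i = 0 := Subsingleton.elim _ _
    have h := card_filter_price_le_mul_le (by positivity) hle hq
    have hone : #{j : Fin m | j = ⟨0, hm⟩} = 1 := by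
      rw [Finset.filter_eq', if_pos (Finset.mem_univ _), Finset.card_singleton]
    simpa [profit, hmem, hbuy, hone] using h
  · rw [hSW, ← hsum]
    exact Finset.sum_congr rfl fun j _ => if_pos (hpos j)
  · rintro w ⟨q, -, rfl⟩
    rw [hSW, ← hsum]
    refine Finset.sum_le_sum fun j _ => ?_
    split_ifs
    exacts [le_rfl, hpos j]
end

section
/- Suppose all production costs are zero (c_i = 0 for all i) and every item i has some buyer j with v_{j,i} > 0. If p is an ε-Nash equilibrium with 0 ≤ ε < min_{i∈N} max_{j∈M} v_{j,i}, then p is market clearing, i.e., every item is sold; in particular every pure Nash equilibrium is market clearing. -/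
open Finset

/-- A sequential demand map: given prices and a set `A` of still-available items,
it selects a subset of `A` maximizing utility, of maximum cardinality among
such maximizers. -/
def IsSeqDemandMap {n : ℕ} (v : Finset (Fin n) → ℝ)
    (D : (Fin n → ℝ) → Finset (Fin n) → Finset (Fin n)) : Prop :=
  ∀ p A, D p A ⊆ A ∧ (∀ S ⊆ A, util v p S ≤ util v p (D p A)) ∧
    ∀ S ⊆ A, util v p S = util v p (D p A) → S.card ≤ (D p A).card

/-- `avail D p j` is the set of items still unsold after buyers `1, …, j` (i.e.
the first `j` buyers, 0-indexed `0, …, j-1`) have purchased in order. -/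
def avail {n m : ℕ} (D : Fin m → (Fin n → ℝ) → Finset (Fin n) → Finset (Fin n))
    (p : Fin n → ℝ) : ℕ → Finset (Fin n)
  | 0 => Finset.univ
  | j + 1 => if h : j < m then avail D p j \ D ⟨j, h⟩ p (avail D p j) else avail D p j

/-- Profit of seller `i`: `p i - c i` if item `i` is sold to some buyer, else `0`. -/
def sprofit {n m : ℕ} (D : Fin m → (Fin n → ℝ) → Finset (Fin n) → Finset (Fin n))
    (c : Fin n → ℝ) (p : Fin n → ℝ) (i : Fin n) : ℝ :=
  if i ∈ avail D p m then 0 else p i - c i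

/-- `ε`-Nash equilibrium of the sequential pricing game (taking `ε = 0` gives a
pure Nash equilibrium). -/
def SeqEpsNE {n m : ℕ} (D : Fin m → (Fin n → ℝ) → Finset (Fin n) → Finset (Fin n))
    (c : Fin n → ℝ) (ε : ℝ) (p : Fin n → ℝ) : Prop :=
  (∀ i, 0 ≤ p i) ∧
    ∀ (i : Fin n) (q : ℝ), 0 ≤ q →
      sprofit D c (Function.update p i q) i ≤ sprofit D c p i + ε

/-- The set of unsold items only shrinks as buyers arrive. -/
theorem avail_antitone {n m : ℕ} (D : Fin m → (Fin n → ℝ) → Finset (Fin n) → Finset (Fin n))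
    (p : Fin n → ℝ) : Antitone (avail D p) := by
  refine antitone_nat_of_succ_le fun j => ?_
  rw [avail]
  split_ifs
  · exact sdiff_subset
  · exact le_rfl

/-- By submodularity, the marginal value of an item is smallest at the full bundle. -/
theorem vmarg_le_insert_sub {n m : ℕ} {v : Fin m → Finset (Fin n) → ℝ} {j : Fin m}
    (hv : IsValuation (v j)) {S : Finset (Fin n)} {i : Fin n} (hi : i ∉ S) :
    vmarg v j i ≤ v j (insert i S) - v j S := by
  have h := hv.2.2.2 S (univ.erase i) i
    (fun x hx => mem_erase.2 ⟨fun h => hi (h ▸ hx), mem_univ x⟩) (notMem_erase i univ)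
  rwa [insert_erase (mem_univ i)] at h

/-- A demanded bundle contains every available item priced below its marginal value. -/
theorem IsSeqDemandMap.mem_of_lt_vmarg {n m : ℕ} {v : Fin m → Finset (Fin n) → ℝ} {j : Fin m}
    {D : (Fin n → ℝ) → Finset (Fin n) → Finset (Fin n)}
    (hD : IsSeqDemandMap (v j) D) (hv : IsValuation (v j)) {p : Fin n → ℝ}
    {A : Finset (Fin n)} {i : Fin n} (hiA : i ∈ A) (hi : p i < vmarg v j i) : i ∈ D p A := by
  by_contra hiD
  obtain ⟨hsub, hmax, -⟩ := hD p A
  have h := hmax (insert i (D p A)) (insert_subset hiA hsub)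
  rw [util, util, sum_insert hiD] at h
  linarith [vmarg_le_insert_sub hv hiD]

/-- An item priced below its marginal value for some buyer is sold. -/
theorem notMem_avail_of_lt_vmarg {n m : ℕ} {v : Fin m → Finset (Fin n) → ℝ} {j : Fin m}
    (hv : IsValuation (v j)) {D : Fin m → (Fin n → ℝ) → Finset (Fin n) → Finset (Fin n)}
    (hD : IsSeqDemandMap (v j) (D j)) {p : Fin n → ℝ} {i : Fin n} (hi : p i < vmarg v j i) :
    i ∉ avail D p m := by
  intro h
  have hsucc := avail_antitone D p (Nat.succ_le_of_lt j.isLt) h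
  rw [Nat.succ_eq_add_one, avail, dif_pos j.isLt, mem_sdiff] at hsucc
  exact hsucc.2 (hD.mem_of_lt_vmarg hv hsucc.1 hi)

/-- in the single-copy sequential game with zero costs, if every
item has a buyer with positive marginal value and
`0 ≤ ε < min_i max_j v_{j,i}` (expressed as: for every item `i` there is a
buyer `j` with `ε < v_{j,i}`), then every `ε`-Nash equilibrium is market
clearing (every item is sold); in particular every pure Nash equilibrium
(`ε = 0`) is market clearing. -/
theorem seq_epsNE_marketClearing {n m : ℕ}
    (v : Fin m → Finset (Fin n) → ℝ)
    (hv : ∀ j, IsValuation (v j))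
    (D : Fin m → (Fin n → ℝ) → Finset (Fin n) → Finset (Fin n))
    (hD : ∀ j, IsSeqDemandMap (v j) (D j))
    (ε : ℝ) (hε0 : 0 ≤ ε)
    (hε : ∀ i : Fin n, ∃ j : Fin m, ε < vmarg v j i)
    (p : Fin n → ℝ) (hp : SeqEpsNE D (fun _ => 0) ε p) :
    avail D p m = ∅ := by
  refine eq_empty_of_forall_notMem fun i hi => ?_
  obtain ⟨j, hj⟩ := hε i
  obtain ⟨q, hεq, hq⟩ := exists_between hj
  have hsold : i ∉ avail D (Function.update p i q) m :=
    notMem_avail_of_lt_vmarg (hv j) (hD j) (by simpa using hq)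
  have h := hp.2 i q (hε0.trans hεq.le)
  simp only [sprofit, if_neg hsold, if_pos hi, Function.update_self] at h
  linarith
end

section
/- Suppose buyer 1 has a normalized monotone submodular valuation whose demand map is up-consistent (for any price vector p, any item i, and any p'_i ≥ p_i, writing p' = (p'_i, p_{−i}), either buyer 1 demands the same set at p' as at p, or buyer 1 does not demand item i at p'), buyers 2,…,m have additive valuations, and sellers have arbitrary production costs c_i ≥ 0. Then for every ε > 0 there exists an ε-Nash equilibrium (not necessarily market clearing). -/
open Finset

/-- An additive buyer takes exactly the available items priced at most at their value. -/
theorem mem_demand_iff_of_isAdditive {n : ℕ} {v : Finset (Fin n) → ℝ}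
    {D : (Fin n → ℝ) → Finset (Fin n) → Finset (Fin n)} (hv : IsAdditive v)
    (hD : IsSeqDemandMap v D) {p : Fin n → ℝ} {A : Finset (Fin n)} {i : Fin n} (hi : i ∈ A) :
    i ∈ D p A ↔ p i ≤ v {i} := by
  obtain ⟨hsub, hmax, hcard⟩ := hD p A
  have hutil : ∀ S, util v p S = ∑ k ∈ S, (v {k} - p k) := fun S => by
    rw [util, hv S, Finset.sum_sub_distrib]
  constructor
  · intro hmem
    have h := hmax ((D p A).erase i) ((Finset.erase_subset _ _).trans hsub)
    rw [hutil, hutil, ← Finset.add_sum_erase _ _ hmem] at h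
    linarith
  · intro hle
    by_contra hmem
    have hins : insert i (D p A) ⊆ A := Finset.insert_subset hi hsub
    have hu : util v p (insert i (D p A)) = v {i} - p i + util v p (D p A) := by
      rw [hutil, hutil, Finset.sum_insert hmem]
    have h := hcard _ hins (le_antisymm (hmax _ hins) (by linarith))
    rw [Finset.card_insert_of_notMem hmem] at h
    omega

section SequentialGame

variable {n m : ℕ} {D : Fin m → (Fin n → ℝ) → Finset (Fin n) → Finset (Fin n)}

theorem mem_avail_iff (p : Fin n → ℝ) (i : Fin n) (k : ℕ) :
    i ∈ avail D p k ↔ ∀ j : Fin m, (j : ℕ) < k → i ∉ D j p (avail D p j) := by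
  induction k with
  | zero => simp [avail]
  | succ k ih =>
    rw [avail]
    split_ifs with h
    · rw [Finset.mem_sdiff, ih]
      constructor
      · rintro ⟨hlt, hk⟩ j hj
        rcases Nat.lt_succ_iff_lt_or_eq.mp hj with hj | rfl
        · exact hlt j hj
        · exact hk
      · exact fun hall => ⟨fun j hj => hall j (by omega), hall ⟨k, h⟩ (Nat.lt_succ_self k)⟩
    · rw [ih]
      exact ⟨fun hall j _ => hall j (by omega), fun hall j hj => hall j (by omega)⟩

/-- An item stays unsold iff the first buyer does not demand it and it is priced strictly
above the value of every other buyer. -/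
theorem mem_avail_final_iff (hm : 0 < m) {v : Fin m → Finset (Fin n) → ℝ}
    (hadd : ∀ j : Fin m, j ≠ ⟨0, hm⟩ → IsAdditive (v j))
    (hD : ∀ j, IsSeqDemandMap (v j) (D j)) (p : Fin n → ℝ) (i : Fin n) :
    i ∈ avail D p m ↔
      i ∉ D ⟨0, hm⟩ p Finset.univ ∧ ∀ j : Fin m, j ≠ ⟨0, hm⟩ → v j {i} < p i := by
  constructor
  · intro h
    have hall := (mem_avail_iff p i m).mp h
    refine ⟨hall ⟨0, hm⟩ hm, fun j hj => ?_⟩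
    have hav : i ∈ avail D p j :=
      (mem_avail_iff p i j).mpr fun l _ => hall l l.isLt
    exact not_le.mp (mt (mem_demand_iff_of_isAdditive (hadd j hj) (hD j) hav).mpr
      (hall j j.isLt))
  · rintro ⟨h0, hlt⟩
    refine (mem_avail_iff p i m).mpr fun j _ => ?_
    by_cases hj : j = ⟨0, hm⟩
    · subst hj
      exact h0
    · intro hmem
      exact absurd ((mem_demand_iff_of_isAdditive (hadd j hj) (hD j)
        ((hD j p _).1 hmem)).mp hmem) (not_le.mpr (hlt j hj))

/-- The larger of the cost of item `i` and the values of `i` for the buyers after the first. -/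
noncomputable def reserve (hm : 0 < m) (v : Fin m → Finset (Fin n) → ℝ) (c : Fin n → ℝ)
    (i : Fin n) : ℝ :=
  Finset.univ.sup' ⟨⟨0, hm⟩, Finset.mem_univ _⟩ fun j => if j = ⟨0, hm⟩ then c i else v j {i}

theorem cost_le_reserve (hm : 0 < m) (v : Fin m → Finset (Fin n) → ℝ) (c : Fin n → ℝ)
    (i : Fin n) : c i ≤ reserve hm v c i := by
  rw [reserve]
  simpa only [if_true] using Finset.le_sup' (fun j => if j = ⟨0, hm⟩ then c i else v j {i})
    (Finset.mem_univ (⟨0, hm⟩ : Fin m))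

theorem value_le_reserve (hm : 0 < m) (v : Fin m → Finset (Fin n) → ℝ) (c : Fin n → ℝ)
    (i : Fin n) {j : Fin m} (hj : j ≠ ⟨0, hm⟩) : v j {i} ≤ reserve hm v c i := by
  rw [reserve]
  simpa only [if_neg hj] using Finset.le_sup' (fun j => if j = ⟨0, hm⟩ then c i else v j {i})
    (Finset.mem_univ j)

theorem sprofit_eq_of_mem_or_eq_reserve (hm : 0 < m) {v : Fin m → Finset (Fin n) → ℝ}
    (hadd : ∀ j : Fin m, j ≠ ⟨0, hm⟩ → IsAdditive (v j))
    (hD : ∀ j, IsSeqDemandMap (v j) (D j)) {c p : Fin n → ℝ} {i : Fin n}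
    (h : i ∈ D ⟨0, hm⟩ p Finset.univ ∨ p i = reserve hm v c i) :
    sprofit D c p i = p i - c i := by
  rw [sprofit]
  split_ifs with hav
  · obtain ⟨hmem, hlt⟩ := (mem_avail_final_iff hm hadd hD p i).mp hav
    have hp := h.resolve_left hmem
    obtain ⟨j, -, hj⟩ := Finset.exists_mem_eq_sup' (s := Finset.univ)
      ⟨⟨0, hm⟩, Finset.mem_univ _⟩
      fun j : Fin m => if j = ⟨0, hm⟩ then c i else v j {i}
    rw [← reserve, ← hp] at hj
    split_ifs at hj with h0
    · linarith
    · exact absurd (hlt j h0) (by linarith)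
  · rfl

theorem sprofit_eq_zero_of_reserve_lt (hm : 0 < m) {v : Fin m → Finset (Fin n) → ℝ}
    (hadd : ∀ j : Fin m, j ≠ ⟨0, hm⟩ → IsAdditive (v j))
    (hD : ∀ j, IsSeqDemandMap (v j) (D j)) {c p : Fin n → ℝ} {i : Fin n}
    (hmem : i ∉ D ⟨0, hm⟩ p Finset.univ) (h : reserve hm v c i < p i) :
    sprofit D c p i = 0 :=
  if_pos ((mem_avail_final_iff hm hadd hD p i).mpr
    ⟨hmem, fun _ hj => (value_le_reserve hm v c i hj).trans_lt h⟩)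

end SequentialGame

/-- Prices above a floor `b` at which undemanded items cost exactly `b` and no demanded item
stays demanded after a price increase of more than `ε`. -/
theorem exists_almost_maximal_prices {n : ℕ} {v : Finset (Fin n) → ℝ}
    {D : (Fin n → ℝ) → Finset (Fin n) → Finset (Fin n)} (hv : v ∅ = 0)
    (hD : IsSeqDemandMap v D)
    (hup : ∀ (p : Fin n → ℝ) (i : Fin n) (q : ℝ), p i ≤ q →
      D (Function.update p i q) Finset.univ = D p Finset.univ ∨
        i ∉ D (Function.update p i q) Finset.univ)
    (b : Fin n → ℝ) {ε : ℝ} (hε : 0 < ε) :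
    ∃ p : Fin n → ℝ, (∀ i, b i ≤ p i) ∧ (∀ i, i ∈ D p Finset.univ ∨ p i = b i) ∧
      ∀ i q, p i + ε < q → i ∉ D (Function.update p i q) Finset.univ := by
  set S := D b Finset.univ
  let P : Set (Fin n → ℝ) :=
    {p | (∀ i, b i ≤ p i) ∧ (∀ i ∉ S, p i = b i) ∧ D p Finset.univ = S}
  have hbP : b ∈ P := ⟨fun _ => le_rfl, fun _ _ => rfl, rfl⟩
  have hbdd : BddAbove ((fun p : Fin n → ℝ => ∑ i ∈ S, p i) '' P) := by
    refine ⟨v S, ?_⟩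
    rintro _ ⟨p, ⟨-, -, hp⟩, rfl⟩
    have h := (hD p Finset.univ).2.1 ∅ (Finset.empty_subset _)
    rw [hp, util, util, hv, Finset.sum_empty] at h
    simp only
    linarith
  obtain ⟨_, ⟨p, hpP, rfl⟩, hsup⟩ :=
    exists_lt_of_lt_csSup (Set.Nonempty.image (fun p : Fin n → ℝ => ∑ i ∈ S, p i) ⟨b, hbP⟩)
      (sub_lt_self _ hε)
  obtain ⟨hbp, hoff, hp⟩ := hpP
  refine ⟨p, hbp, fun i => ?_, fun i q hq hmem => ?_⟩
  · rw [hp]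
    exact or_iff_not_imp_left.mpr (hoff i)
  · have hDq : D (Function.update p i q) Finset.univ = S :=
      ((hup p i q (by linarith)).resolve_right (not_not.mpr hmem)).trans hp
    have hiS : i ∈ S := hDq ▸ hmem
    have hqP : Function.update p i q ∈ P := by
      refine ⟨fun k => ?_, fun k hk => ?_, hDq⟩
      · rcases eq_or_ne k i with rfl | hk
        · rw [Function.update_self]
          linarith [hbp k]
        · rw [Function.update_of_ne hk]
          exact hbp k
      · rw [Function.update_of_ne (ne_of_mem_of_not_mem hiS hk).symm]
        exact hoff k hk
    have hle := le_csSup hbdd (Set.mem_image_of_mem _ hqP)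
    simp only [Finset.sum_update_of_mem hiS, ← Finset.erase_eq] at hle
    have hsum := Finset.add_sum_erase S p hiS
    linarith

/-- single-copy sequential game with arbitrary nonnegative
production costs, buyer 1 submodular with an up-consistent demand map, buyers
`2, …, m` additive. Then for every `ε > 0` there exists an `ε`-Nash equilibrium
(not necessarily market clearing). -/
theorem seq_exists_epsNE_with_costs {n m : ℕ} (hm : 0 < m)
    (v : Fin m → Finset (Fin n) → ℝ)
    (hv : ∀ j, IsValuation (v j))
    (hadd : ∀ j : Fin m, j ≠ ⟨0, hm⟩ → IsAdditive (v j))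
    (c : Fin n → ℝ) (hc : ∀ i, 0 ≤ c i)
    (D : Fin m → (Fin n → ℝ) → Finset (Fin n) → Finset (Fin n))
    (hD : ∀ j, IsSeqDemandMap (v j) (D j))
    (hup : ∀ (p : Fin n → ℝ) (i : Fin n) (q : ℝ), p i ≤ q →
      D ⟨0, hm⟩ (Function.update p i q) Finset.univ = D ⟨0, hm⟩ p Finset.univ ∨
        i ∉ D ⟨0, hm⟩ (Function.update p i q) Finset.univ)
    (ε : ℝ) (hε : 0 < ε) :
    ∃ p : Fin n → ℝ, SeqEpsNE D c ε p := by
  obtain ⟨p, hbp, hfloor, hraise⟩ :=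
    exists_almost_maximal_prices (hv ⟨0, hm⟩).1 (hD ⟨0, hm⟩) hup (reserve hm v c) hε
  have hcp : ∀ i, c i ≤ p i := fun i => (cost_le_reserve hm v c i).trans (hbp i)
  refine ⟨p, fun i => (hc i).trans (hcp i), fun i q _ => ?_⟩
  rw [sprofit_eq_of_mem_or_eq_reserve hm hadd hD (hfloor i)]
  have hi := hcp i
  rcases le_or_gt q (p i + ε) with hq | hq
  · rw [sprofit, Function.update_self]
    split_ifs <;> linarith
  · rw [sprofit_eq_zero_of_reserve_lt hm hadd hD (v := v) (hraise i q hq)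
      (by rw [Function.update_self]; linarith [hbp i])]
    linarith
end

section
/- Suppose some item i ∈ N satisfies v_{2,i} > 2·v_{1,i}. Then for every demand map of buyer 1 as in the model, in every pure Nash equilibrium p, item i is not sold to buyer 1, i.e., i ∉ S_1(p). -/
open Finset

/-- The set purchased by the (budgetless) additive buyer 2: all items priced at
most their value. -/
noncomputable def buyer2set {n : ℕ} (v2 : Fin n → ℝ) (p : Fin n → ℝ) : Finset (Fin n) :=
  Finset.univ.filter fun i => p i ≤ v2 i

/-- `D1` is a demand map for the budgeted additive buyer 1 with values `v1` and
budget `B`: at every price vector it selects a budget-feasible bundle maximizing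
additive utility, of maximum cardinality among such maximizers. -/
def IsBudgetDemand {n : ℕ} (v1 : Fin n → ℝ) (B : ℝ)
    (D1 : (Fin n → ℝ) → Finset (Fin n)) : Prop :=
  ∀ p, (∑ i ∈ D1 p, p i ≤ B) ∧
    (∀ S : Finset (Fin n), ∑ i ∈ S, p i ≤ B →
      ∑ i ∈ S, (v1 i - p i) ≤ ∑ i ∈ D1 p, (v1 i - p i)) ∧
    ∀ S : Finset (Fin n), ∑ i ∈ S, p i ≤ B →
      ∑ i ∈ S, (v1 i - p i) = ∑ i ∈ D1 p, (v1 i - p i) → S.card ≤ (D1 p).card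

/-- Profit of seller `i` (two copies, zero production cost): number of buyers
purchasing item `i` times its price. -/
noncomputable def bprofit {n : ℕ} (v2 : Fin n → ℝ) (D1 : (Fin n → ℝ) → Finset (Fin n))
    (p : Fin n → ℝ) (i : Fin n) : ℝ :=
  (((if i ∈ D1 p then 1 else 0) + (if i ∈ buyer2set v2 p then 1 else 0) : ℝ)) * p i

/-- Pure Nash equilibrium of the budgeted two-copy pricing game. -/
def BPNE {n : ℕ} (v2 : Fin n → ℝ) (D1 : (Fin n → ℝ) → Finset (Fin n))
    (p : Fin n → ℝ) : Prop :=
  (∀ i, 0 ≤ p i) ∧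
    ∀ (i : Fin n) (q : ℝ), 0 ≤ q →
      bprofit v2 D1 (Function.update p i q) i ≤ bprofit v2 D1 p i

/-- Market clearing: both buyers purchase every item. -/
def BMarketClearing {n : ℕ} (v2 : Fin n → ℝ) (D1 : (Fin n → ℝ) → Finset (Fin n))
    (p : Fin n → ℝ) : Prop :=
  D1 p = Finset.univ ∧ buyer2set v2 p = Finset.univ

/-- An item with nonnegative price bought by the budgeted buyer costs at most its value:
otherwise dropping it is feasible and strictly better. -/
theorem IsBudgetDemand.price_le {n : ℕ} {v1 : Fin n → ℝ} {B : ℝ}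
    {D1 : (Fin n → ℝ) → Finset (Fin n)} (hD1 : IsBudgetDemand v1 B D1)
    {p : Fin n → ℝ} {i : Fin n} (hpi : 0 ≤ p i) (hmem : i ∈ D1 p) :
    p i ≤ v1 i := by
  obtain ⟨hfeas, hopt, -⟩ := hD1 p
  have hprice := Finset.add_sum_erase (D1 p) p hmem
  have hutil := Finset.add_sum_erase (D1 p) (fun j => v1 j - p j) hmem
  have hdrop := hopt ((D1 p).erase i) (by linarith)
  linarith

/-- Observation 3 in the appendix: if some item `i` satisfies
`v_{2,i} > 2 v_{1,i}`, then in every pure Nash equilibrium, item `i` is not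
sold to the budgeted buyer 1. -/
theorem budget_item_not_sold_to_buyer1 {n : ℕ}
    (v1 v2 : Fin n → ℝ) (hv1 : ∀ i, 0 ≤ v1 i) (hv2 : ∀ i, 0 ≤ v2 i)
    (B : ℝ) (hB : 0 < B)
    (i : Fin n) (hi : 2 * v1 i < v2 i)
    (D1 : (Fin n → ℝ) → Finset (Fin n)) (hD1 : IsBudgetDemand v1 B D1)
    (p : Fin n → ℝ) (hp : BPNE v2 D1 p) :
    i ∉ D1 p := by
  intro hmem
  have hpi := hp.1 i
  have hle := hD1.price_le hpi hmem
  have hdev := hp.2 i (v2 i) (hv2 i)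
  have hlow : v2 i ≤ bprofit v2 D1 (Function.update p i (v2 i)) i := by
    have := hv2 i
    simp only [bprofit, buyer2set, Finset.mem_filter, Finset.mem_univ, Function.update_self,
      le_refl, and_self, if_true]
    split_ifs <;> linarith
  have hup : bprofit v2 D1 p i ≤ 2 * p i := by
    unfold bprofit
    split_ifs <;> linarith
  linarith
end
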